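/- Let a, b be natural numbers. For every path w ∈ D_{a,b} there exists a natural number k such that A(w) = (2a+b)²/2 − a² − 2k; that is, the area deficit from the maximal area (2a+b)²/2 − a² is always an even nonnegative integer. -/

import Mathlib

noncomputable section

open Finset

/-- Height of the path `w` (of length `L`, up = `true`, down = `false`) after `i` steps. -/
def height {L : ℕ} (w : Fin L → Bool) (i : ℕ) : ℤ :=
  ∑ j ∈ Finset.univ.filter (fun j : Fin L => (j : ℕ) < i),
    (if w j then (1 : ℤ) else -1)

/-- `DyckSet a b`: the set `D_{a,b}` of paths of length `2a+b` with `a+b` up steps whose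
heights stay nonnegative. -/
def DyckSet (a b : ℕ) : Finset (Fin (2 * a + b) → Bool) :=
  Finset.univ.filter (fun w =>
    (Finset.univ.filter (fun j => w j = true)).card = a + b ∧
      ∀ i ≤ 2 * a + b, 0 ≤ height w i)

/-- The area `A(w)` between the path `w` and the x-axis. -/
def area {L : ℕ} (w : Fin L → Bool) : ℝ :=
  (∑ i ∈ Finset.range L, ((height w i + height w (i + 1) : ℤ) : ℝ)) / 2

/-- The weighted path sum `M_{2a+b,b}(t) = Σ_{w ∈ D_{a,b}} t^{A(w)}`. -/
def M (a b : ℕ) (t : ℝ) : ℝ := ∑ w ∈ DyckSet a b, t ^ area w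

/-- `M_{ℓ,m}(t)` for `ℓ ≥ m` with `ℓ - m` even. -/
def Mlm (ℓ m : ℕ) (t : ℝ) : ℝ := M ((ℓ - m) / 2) m t

/-- `P k`: the number of partitions of `k`. -/
def P (k : ℕ) : ℕ := Fintype.card (Nat.Partition k)

/-- `C(t) = Σ_{k=0}^∞ P(k) t^{-2k}`. -/
def C (t : ℝ) : ℝ := ∑' k : ℕ, (P k : ℝ) * t ^ (-(2 : ℝ) * k)

theorem height_succ {L : ℕ} (w : Fin L → Bool) {i : ℕ} (hi : i < L) :
    height w (i + 1) = height w i + if w ⟨i, hi⟩ then 1 else -1 := by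
  have h : Finset.univ.filter (fun j : Fin L => (j : ℕ) < i + 1) =
      insert ⟨i, hi⟩ (Finset.univ.filter (fun j : Fin L => (j : ℕ) < i)) := by
    ext j
    simp only [Finset.mem_filter, Finset.mem_univ, true_and, Finset.mem_insert, Fin.ext_iff]
    omega
  unfold height
  rw [h, Finset.sum_insert (by simp), add_comm]

theorem height_length {L : ℕ} (w : Fin L → Bool) :
    height w L = 2 * (Finset.univ.filter (fun j => w j = true)).card - L := by
  have h (j : Fin L) : (if w j then (1 : ℤ) else -1) = 2 * (if w j = true then 1 else 0) - 1 := by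
    split_ifs <;> norm_num
  simp only [height, h, Finset.sum_sub_distrib, ← Finset.mul_sum, Finset.sum_boole, Fin.is_lt,
    Finset.filter_true]
  simp

/-- The initial segment of length `i` with `d` down steps has twice its area equal to
`i² - 2d² - 4k` for some natural number `k`. -/
theorem exists_area_take_eq {L : ℕ} (w : Fin L → Bool) (i : ℕ) (hi : i ≤ L) :
    ∃ d k : ℕ, height w i = i - 2 * d ∧
      ∑ j ∈ Finset.range i, (height w j + height w (j + 1)) =
        (i : ℤ) ^ 2 - 2 * (d : ℤ) ^ 2 - 4 * k := by
  induction i with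
  | zero => exact ⟨0, 0, by simp [height], by simp⟩
  | succ i ih =>
    obtain ⟨d, k, hd, hk⟩ := ih (by omega)
    have hs := height_succ w (i := i) hi
    rw [Finset.sum_range_succ, hk, hs, hd]
    split_ifs
    · exact ⟨d, k + d, by push_cast; ring, by push_cast; ring⟩
    · exact ⟨d + 1, k, by push_cast; ring, by push_cast; ring⟩

/-- The area deficit from the maximal area `(2a+b)²/2 - a²` is an even nonnegative integer:
for every `w ∈ D_{a,b}` there is `k : ℕ` with `A(w) = (2a+b)²/2 - a² - 2k`. -/
theorem stmt_5 (a b : ℕ) (w : Fin (2 * a + b) → Bool) (hw : w ∈ DyckSet a b) :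
    ∃ k : ℕ, area w = ((2 * a + b : ℕ) : ℝ) ^ 2 / 2 - (a : ℝ) ^ 2 - 2 * k := by
  obtain ⟨d, k, hd, hk⟩ := exists_area_take_eq w _ le_rfl
  have hcard := (Finset.mem_filter.mp hw).2.1
  rw [height_length, hcard] at hd
  obtain rfl : d = a := by push_cast at hd; omega
  refine ⟨k, ?_⟩
  rw [area, ← Int.cast_sum, hk]
  push_cast
  ring
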